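/- Let U = [[A_U, B_U],[C_U, D_U]] and V = [[A_V, B_V],[C_V, D_V]] be complex block matrices with square blocks, where A_U and A_V are group invertible. Suppose R(B_U) ⊆ R(A_U) and R(C_Vᴴ) ⊆ R(A_Vᴴ). If (U, V) is a group inverse absorbing pair, then (A_U, A_V) is also a group inverse absorbing pair. -/

import Mathlib

open Matrix

/-- `X` is the group inverse of `A`. -/
def IsGroupInverse {n : Type*} [Fintype n] (A X : Matrix n n ℂ) : Prop :=
  A * X * A = A ∧ X * A * X = X ∧ A * X = X * A

/-- The column space (range) of a complex matrix. -/
noncomputable def colSpace {m n : Type*} [Fintype n] (A : Matrix m n ℂ) :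
    Submodule ℂ (m → ℂ) :=
  LinearMap.range A.mulVecLin

/-- A matrix whose column space lies in that of `A` factors through `A` on the left. -/
theorem exists_eq_mul_of_colSpace_le {m n k : Type*} [Fintype n] [Fintype k]
    {A : Matrix m n ℂ} {B : Matrix m k ℂ} (h : colSpace B ≤ colSpace A) :
    ∃ W : Matrix n k ℂ, B = A * W := by
  classical
  have hcol (j : k) : ∃ w : n → ℂ, A *ᵥ w = B.col j := by
    have hj : B.col j ∈ colSpace B := ⟨Pi.single j 1, by simp⟩
    exact h hj
  choose w hw using hcol
  refine ⟨Matrix.of fun i j => w j i, ?_⟩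
  ext i j
  exact (congrFun (hw j) i).symm

namespace IsGroupInverse

variable {n : Type*} [Fintype n] {A B X Y : Matrix n n ℂ}

theorem mul_mul_inv (h : IsGroupInverse A X) : A * X * X = X := by
  rw [h.2.2, h.2.1]

theorem inv_mul_mul (h : IsGroupInverse A X) : X * X * A = X := by
  rw [mul_assoc, ← h.2.2, ← mul_assoc, h.2.1]

theorem mul_mul_self (h : IsGroupInverse A X) : X * A * A = A := by
  rw [← h.2.2, h.1]

theorem self_mul_mul (h : IsGroupInverse A X) : A * A * X = A := by
  rw [mul_assoc, h.2.2, ← mul_assoc, h.1]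

/-- Group invertible matrices `A`, `B` form an absorbing pair exactly when `B` is a right multiple
of `A` and `A` is a left multiple of `B`. -/
theorem absorbing_iff (hA : IsGroupInverse A X) (hB : IsGroupInverse B Y) :
    X + Y = X * (A + B) * Y ↔ (∃ P, B = A * P) ∧ ∃ Q, A = Q * B := by
  constructor
  · intro h
    have hY : A * X * Y = Y := by
      have h' : A * X * (X + Y) = X + Y := by
        rw [h, ← mul_assoc, ← mul_assoc, hA.mul_mul_inv]
      rw [mul_add, hA.mul_mul_inv] at h'
      exact add_left_cancel h'
    have hX : X * (B * Y) = X := by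
      have h' : (X + Y) * (B * Y) = X + Y := by
        rw [h, mul_assoc (X * (A + B)), ← mul_assoc Y, hB.2.1]
      rw [add_mul, ← mul_assoc Y, hB.2.1] at h'
      exact add_right_cancel h'
    refine ⟨⟨X * Y * B * B, ?_⟩, ⟨A * A * X * Y, ?_⟩⟩
    · simp only [← mul_assoc, hY, hB.mul_mul_self]
    · rw [mul_assoc _ Y, ← hB.2.2, mul_assoc _ X, hX, hA.self_mul_mul]
  · rintro ⟨⟨P, hP⟩, Q, hQ⟩
    have hY : X * A * Y = Y := by
      have hAB : A * X * B = B := by rw [hP, ← mul_assoc, hA.1]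
      calc X * A * Y = A * X * B * Y * Y := by
            rw [← hA.2.2, mul_assoc (A * X) B, mul_assoc (A * X), hB.mul_mul_inv]
        _ = Y := by rw [hAB, hB.mul_mul_inv]
    have hX : X * B * Y = X := by
      have hAB : A * (Y * B) = A := by rw [hQ, mul_assoc, ← mul_assoc B, hB.1]
      calc X * B * Y = X * X * (A * (Y * B)) := by
            rw [← mul_assoc, hA.inv_mul_mul, mul_assoc, hB.2.2]
        _ = X := by rw [hAB, hA.inv_mul_mul]
    rw [mul_add, add_mul, hY, hX, add_comm]

end IsGroupInverse

theorem inheritance_leading_block_group_absorbing {a d : ℕ}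
    (AU : Matrix (Fin a) (Fin a) ℂ) (BU : Matrix (Fin a) (Fin d) ℂ)
    (CU : Matrix (Fin d) (Fin a) ℂ) (DU : Matrix (Fin d) (Fin d) ℂ)
    (AV : Matrix (Fin a) (Fin a) ℂ) (BV : Matrix (Fin a) (Fin d) ℂ)
    (CV : Matrix (Fin d) (Fin a) ℂ) (DV : Matrix (Fin d) (Fin d) ℂ)
    (AUg AVg : Matrix (Fin a) (Fin a) ℂ)
    (hAU : IsGroupInverse AU AUg) (hAV : IsGroupInverse AV AVg)
    (Ug Vg : Matrix (Fin a ⊕ Fin d) (Fin a ⊕ Fin d) ℂ)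
    (hU : IsGroupInverse (Matrix.fromBlocks AU BU CU DU) Ug)
    (hV : IsGroupInverse (Matrix.fromBlocks AV BV CV DV) Vg)
    (h1 : colSpace BU ≤ colSpace AU)
    (h2 : colSpace CVᴴ ≤ colSpace AVᴴ)
    (habs : Ug + Vg =
      Ug * (Matrix.fromBlocks AU BU CU DU + Matrix.fromBlocks AV BV CV DV) * Vg) :
    AUg + AVg = AUg * (AU + AV) * AVg := by
  obtain ⟨⟨P, hP⟩, Q, hQ⟩ := (hU.absorbing_iff hV).1 habs
  obtain ⟨W, hW⟩ := exists_eq_mul_of_colSpace_le h1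
  obtain ⟨Z, hZ⟩ := exists_eq_mul_of_colSpace_le h2
  have hCV : CV = Zᴴ * AV := by
    rw [← conjTranspose_conjTranspose CV, hZ, conjTranspose_mul, conjTranspose_conjTranspose]
  refine (hAU.absorbing_iff hAV).2
    ⟨⟨P.toBlocks₁₁ + W * P.toBlocks₂₁, ?_⟩, ⟨Q.toBlocks₁₁ + Q.toBlocks₁₂ * Zᴴ, ?_⟩⟩
  · rw [← fromBlocks_toBlocks P, fromBlocks_multiply] at hP
    rw [(fromBlocks_inj.1 hP).1, hW, Matrix.mul_add, Matrix.mul_assoc]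
  · rw [← fromBlocks_toBlocks Q, fromBlocks_multiply] at hQ
    rw [(fromBlocks_inj.1 hQ).1, hCV, Matrix.add_mul, Matrix.mul_assoc]
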